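/- arXiv:2512.14934 — 3 statements merged into one kernel-verified Lean document; each statement's English description precedes it below -/
import Mathlib

section
/- Let n ≥ 1 and let Bⁿ denote the closed unit ball in n-dimensional Euclidean space. If f : Bⁿ → Bⁿ is ε-continuous for some ε ≥ 0, then for every ε' > ε/Rₙ (where Rₙ = √(2(n+1)/n)) the function f has an ε'-fixed point, i.e., there exists x ∈ Bⁿ with ‖x − f(x)‖ ≤ ε'. -/
/-- A function between metric spaces is `ε`-continuous if every point has a
neighborhood whose image has diameter at most `ε`. -/
def EpsContinuous {X Y : Type*} [MetricSpace X] [MetricSpace Y] (ε : ℝ) (f : X → Y) : Prop :=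
  ∀ x : X, ∃ U ∈ nhds x, ∀ a ∈ U, ∀ b ∈ U, dist (f a) (f b) ≤ ε

open Set Metric MeasureTheory Topology

theorem jung_point {n : ℕ} (hn : 1 ≤ n) (S : Set (EuclideanSpace ℝ (Fin n))) (ε : ℝ)
    (hε : 0 ≤ ε) (hS : ∀ a ∈ S, ∀ b ∈ S, dist a b ≤ ε) (x : EuclideanSpace ℝ (Fin n))
    (hx : x ∈ convexHull ℝ S) :
    ∃ s ∈ S, ‖x - s‖ ≤ ε / Real.sqrt (2 * (n + 1) / n) := by
  classical
  obtain ⟨ι, hι, z, w, hz, haff, hw, hw1, hwx⟩ := eq_pos_convex_span_of_mem_convexHull hx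
  have hcard : Fintype.card ι ≤ n + 1 := by
    have h1 := haff.card_le_finrank_succ
    have h2 := Submodule.finrank_le (vectorSpan ℝ (range z))
    rw [finrank_euclideanSpace_fin] at h2
    omega
  have hn0 : (0 : ℝ) < n := by exact_mod_cast hn
  have hsq : 1 ≤ (n + 1) * ∑ i, w i ^ 2 := by
    have h := sq_sum_le_card_mul_sum_sq (s := Finset.univ) (f := w)
    rw [hw1] at h
    have h3 : (0 : ℝ) ≤ ∑ i, w i ^ 2 := Finset.sum_nonneg fun i _ => sq_nonneg _
    have h4 : ((Finset.univ : Finset ι).card : ℝ) ≤ n + 1 := by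
      rw [Finset.card_univ]; exact_mod_cast hcard
    nlinarith
  have hid : ∑ i, w i * ‖x - z i‖ ^ 2 = (1 / 2) * ∑ i, ∑ j, w i * w j * ‖z i - z j‖ ^ 2 := by
    have e1 : ∀ i j, w i * w j * ‖z i - z j‖ ^ 2 = w j * (w i * ‖x - z i‖ ^ 2)
        + w i * (w j * ‖x - z j‖ ^ 2) - 2 * (inner ℝ (w i • (x - z i)) (w j • (x - z j))) := by
      intro i j
      have : z i - z j = (x - z j) - (x - z i) := by abel
      rw [this, norm_sub_sq_real, inner_smul_left, inner_smul_right, real_inner_comm]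
      simp; ring
    have e2 : ∑ i, w i • (x - z i) = 0 := by
      simp [smul_sub, Finset.sum_sub_distrib, hwx, ← Finset.sum_smul, hw1]
    simp_rw [e1, Finset.sum_sub_distrib, Finset.sum_add_distrib, ← Finset.mul_sum, ← inner_sum,
      ← sum_inner, e2, ← Finset.sum_mul, hw1]
    simp; ring
  have hbound : ∑ i, ∑ j, w i * w j * ‖z i - z j‖ ^ 2 ≤ ε ^ 2 * (1 - ∑ i, w i ^ 2) := by
    have e : (1 : ℝ) - ∑ i, w i ^ 2 = ∑ i, ∑ j, (w i * w j - if i = j then w i ^ 2 else 0) := by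
      simp [Finset.sum_sub_distrib, ← Finset.mul_sum, hw1]
    rw [e, Finset.mul_sum]
    refine Finset.sum_le_sum fun i _ => ?_
    rw [Finset.mul_sum]
    refine Finset.sum_le_sum fun j _ => ?_
    by_cases hij : i = j
    · subst hij; simp [sq]
    · simp only [hij, if_false, sub_zero]
      rw [mul_comm]
      have h1 : ‖z i - z j‖ ≤ ε := by
        rw [← dist_eq_norm]; exact hS _ (hz ⟨i, rfl⟩) _ (hz ⟨j, rfl⟩)
      have := (hw i).le
      have := (hw j).le
      gcongr
  set ρ := ε / Real.sqrt (2 * (n + 1) / n) with hρ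
  have hρ0 : 0 ≤ ρ := by positivity
  have hρ2 : ρ ^ 2 = ε ^ 2 * n / (2 * (n + 1)) := by
    rw [hρ, div_pow, Real.sq_sqrt (by positivity)]; field_simp
  have hfin : ∑ i, w i * ‖x - z i‖ ^ 2 ≤ ρ ^ 2 := by
    rw [hid, hρ2, le_div_iff₀ (by positivity)]
    nlinarith [mul_nonneg (sq_nonneg ε) (sub_nonneg.2 hsq), mul_le_mul_of_nonneg_left hbound hn0.le]
  by_contra hcon
  push Not at hcon
  have hne : (Finset.univ : Finset ι).Nonempty := by
    rw [Finset.nonempty_iff_ne_empty]; intro h; rw [h] at hw1; simp at hw1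
  have : ∑ i, w i * ρ ^ 2 < ∑ i, w i * ‖x - z i‖ ^ 2 := by
    refine Finset.sum_lt_sum_of_nonempty hne fun i _ => ?_
    have := hcon (z i) (hz ⟨i, rfl⟩)
    have := hw i
    gcongr
  rw [← Finset.sum_mul, hw1] at this
  linarith

section
variable {n : ℕ}
local notation "E" => EuclideanSpace ℝ (Fin n)

theorem exists_sphere_between (x y : E) (hx : ‖x‖ ≤ 1) (hy : 1 < ‖y‖) :
    ∃ z, ‖z‖ = 1 ∧ ‖x - z‖ ≤ ‖x - y‖ := by
  have hc : ContinuousOn (fun s : ℝ => ‖x + s • (y - x)‖) (Icc 0 1) := by fun_prop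
  have := intermediate_value_Icc zero_le_one hc
  obtain ⟨s, hs, h⟩ := this (show (1 : ℝ) ∈ _ from ⟨by simpa using hx, by simpa using hy.le⟩)
  refine ⟨_, h, ?_⟩
  simp only [sub_add_cancel_left, norm_neg, norm_smul, Real.norm_eq_abs, abs_of_nonneg hs.1]
  rw [norm_sub_rev x y]
  nlinarith [norm_nonneg (y - x), hs.2]

theorem lipschitz_ext (h : E → E) (K : NNReal) (hK : LipschitzOnWith K h (closedBall 0 1))
    (h0 : ∀ x, ‖x‖ = 1 → h x = 0) :
    ∃ H : E → E, LipschitzWith K H ∧ (∀ x, ‖x‖ ≤ 1 → H x = h x) ∧ ∀ x, 1 < ‖x‖ → H x = 0 := by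
  classical
  refine ⟨fun x => if ‖x‖ ≤ 1 then h x else 0, ?_, fun x hx => by simp [hx], fun x hx => by
    simp [hx]⟩
  have key : ∀ x y : E, ‖x‖ ≤ 1 → 1 < ‖y‖ → dist (h x) 0 ≤ K * dist x y := by
    intro x y hx hy
    obtain ⟨z, hz, hzz⟩ := exists_sphere_between x y hx hy
    rw [← h0 z hz]
    refine (hK.dist_le_mul x (by simpa) z (by simp [hz])).trans ?_
    rw [dist_eq_norm, dist_eq_norm]
    gcongr
  refine LipschitzWith.of_dist_le_mul fun x y => ?_
  by_cases hx : ‖x‖ ≤ 1 <;> by_cases hy : ‖y‖ ≤ 1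
  · simp only [hx, hy, if_true]; exact hK.dist_le_mul x (by simpa) y (by simpa)
  · simp only [hx, hy, if_true, if_false]; exact key x y hx (not_le.1 hy)
  · simp only [hx, hy, if_true, if_false]
    rw [dist_comm, dist_comm x y]; exact key y x hy (not_le.1 hx)
  · simp only [hx, hy, if_false, dist_self]; positivity

theorem perturb_bij (h : E → E) (K : NNReal) (hK : LipschitzOnWith K h (closedBall 0 1))
    (h0 : ∀ x, ‖x‖ = 1 → h x = 0) (h1 : ∀ x, ‖x‖ ≤ 1 → ‖x + h x‖ ≤ 1)
    (t : ℝ) (ht0 : 0 ≤ t) (ht1 : t ≤ 1) (htK : t * K < 1) :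
    InjOn (fun x => x + t • h x) (closedBall 0 1) ∧
      (fun x => x + t • h x) '' (closedBall 0 1) = closedBall 0 1 := by
  obtain ⟨H, HL, Hin, Hout⟩ := lipschitz_ext h K hK h0
  refine ⟨?_, Subset.antisymm ?_ ?_⟩
  · intro x hx y hy hxy
    simp only at hxy
    have e : x - y = t • (h y - h x) := by
      rw [smul_sub, sub_eq_sub_iff_add_eq_add, hxy, add_comm]
    have l := hK.dist_le_mul y hy x hx
    rw [dist_comm y x, dist_eq_norm, dist_eq_norm] at l
    have e2 := congrArg norm e
    rw [norm_smul, Real.norm_eq_abs, abs_of_nonneg ht0] at e2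
    by_contra hne
    have : 0 < ‖x - y‖ := norm_pos_iff.2 (sub_ne_zero.2 hne)
    nlinarith
  · rintro _ ⟨x, hx, rfl⟩
    simp only [mem_closedBall, dist_zero_right] at hx ⊢
    have : x + t • h x = (1 - t) • x + t • (x + h x) := by module
    rw [this]
    refine (norm_add_le _ _).trans ?_
    rw [norm_smul, norm_smul, Real.norm_eq_abs, Real.norm_eq_abs, abs_of_nonneg ht0,
      abs_of_nonneg (sub_nonneg.2 ht1)]
    nlinarith [h1 x hx]
  · intro y hy
    have hc : ContractingWith (t.toNNReal * K) (fun x => y - t • H x) := by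
      refine ⟨by rw [← NNReal.coe_lt_coe]; simpa [ht0] using htK, LipschitzWith.of_dist_le_mul ?_⟩
      intro a b
      rw [dist_sub_left, dist_smul₀, Real.norm_eq_abs, abs_of_nonneg ht0]
      have := HL.dist_le_mul a b
      simp only [NNReal.coe_mul, Real.coe_toNNReal t ht0, mul_assoc]
      gcongr
    have hfix : y - t • H (hc.fixedPoint _) = hc.fixedPoint _ := hc.fixedPoint_isFixedPt
    set x := hc.fixedPoint _
    have hx : ‖x‖ ≤ 1 := by
      by_contra hcon
      rw [Hout x (not_le.1 hcon)] at hfix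
      simp only [smul_zero, sub_zero] at hfix
      exact hcon (by rw [← hfix]; simpa using hy)
    refine ⟨x, by simpa using hx, ?_⟩
    simp only
    rw [← Hin x hx]
    nth_rewrite 1 [← hfix]
    abel

theorem exists_det_poly (A : E →L[ℝ] E) :
    ∃ p : Polynomial ℝ, p.natDegree ≤ n ∧
      ∀ t : ℝ, p.eval t = (ContinuousLinearMap.id ℝ E + t • A).det := by
  let b := (EuclideanSpace.basisFun (Fin n) ℝ).toBasis
  let M := LinearMap.toMatrix b b (A : E →ₗ[ℝ] E)
  refine ⟨Matrix.det ((Polynomial.X : Polynomial ℝ) • M.map Polynomial.C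
    + (1 : Matrix (Fin n) (Fin n) ℝ).map Polynomial.C), ?_, ?_⟩
  · simpa using Polynomial.natDegree_det_X_add_C_le M 1
  · intro t
    have : (ContinuousLinearMap.id ℝ E + t • A).det = (1 + t • M).det := by
      rw [ContinuousLinearMap.det, ← LinearMap.det_toMatrix b]
      congr 1
      simp [M]
    rw [this, ← Polynomial.coe_evalRingHom, RingHom.map_det]
    congr 1
    ext i j
    by_cases hij : i = j <;> simp [hij, add_comm, mul_comm t]

theorem det_fderiv_zero (U : Set E) (hU : IsOpen U) (h : E → E) (hh : ContDiffOn ℝ 1 h U)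
    (hBU : closedBall 0 1 ⊆ U) (hr : ∀ x, ‖x‖ ≤ 1 → ‖x + h x‖ = 1) (x : E) (hx : ‖x‖ < 1) :
    (ContinuousLinearMap.id ℝ E + (1 : ℝ) • fderiv ℝ h x).det = 0 := by
  have hxU : U ∈ 𝓝 x := hU.mem_nhds (hBU (by simpa using hx.le))
  have hd : HasFDerivAt h (fderiv ℝ h x) x :=
    ((hh.contDiffAt hxU).differentiableAt (by norm_num)).hasFDerivAt
  have hd2 : HasFDerivAt (fun y => y + h y) (ContinuousLinearMap.id ℝ E + fderiv ℝ h x) x :=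
    (hasFDerivAt_id x).add hd
  have hd3 := hd2.norm_sq
  have hc : (fun y : E => ‖y + h y‖ ^ 2) =ᶠ[𝓝 x] fun _ => (1 : ℝ) := by
    filter_upwards [isOpen_ball.mem_nhds (show x ∈ ball (0 : E) 1 by simpa using hx)] with y hy
    have := hr y (by simpa using (mem_ball_zero_iff.1 hy).le)
    simp [this]
  have hd4 := (hasFDerivAt_const (𝕜 := ℝ) (1 : ℝ) x).congr_of_eventuallyEq hc
  have heq := hd3.unique hd4
  rw [one_smul]
  by_contra hdet
  have hsurj : Function.Surjective (ContinuousLinearMap.id ℝ E + fderiv ℝ h x) := by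
    have hu : IsUnit (LinearMap.det ((ContinuousLinearMap.id ℝ E + fderiv ℝ h x : E →L[ℝ] E) : E →ₗ[ℝ] E)) :=
      isUnit_iff_ne_zero.2 hdet
    have := (LinearMap.isUnit_iff_isUnit_det _).2 hu
    exact ((Module.End.isUnit_iff _).1 this).2
  obtain ⟨v, hv⟩ := hsurj (x + h x)
  have := congrArg (fun L => L v) heq
  simp at this
  have hv' : v + fderiv ℝ h x v = x + h x := by simpa using hv
  have e : inner ℝ (x + h x) (v + fderiv ℝ h x v) = 0 := by
    simp only [inner_add_left, inner_add_right] at this ⊢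
    linarith
  rw [hv', real_inner_self_eq_norm_sq, hr x hx.le] at e
  norm_num at e

theorem no_retraction (U : Set E) (hU : IsOpen U) (h : E → E) (hh : ContDiffOn ℝ 1 h U)
    (hBU : closedBall 0 1 ⊆ U) (h0 : ∀ x, ‖x‖ = 1 → h x = 0)
    (hr : ∀ x, ‖x‖ ≤ 1 → ‖x + h x‖ = 1) : False := by
  let B : Set E := closedBall 0 1
  have hBc : IsCompact B := isCompact_closedBall _ _
  have hcd : ∀ x ∈ B, ContDiffAt ℝ 1 h x := fun x hx => hh.contDiffAt (hU.mem_nhds (hBU hx))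
  obtain ⟨K, hK⟩ : ∃ K, LipschitzOnWith K h B := by
    refine LocallyLipschitzOn.exists_lipschitzOnWith_of_compact hBc ?_
    intro x hx
    obtain ⟨K, s, hs, hl⟩ := (hcd x hx).exists_lipschitzOnWith
    exact ⟨K, s, mem_nhdsWithin_of_mem_nhds hs, hl⟩
  have hcf : ∀ x ∈ B, ContinuousAt (fderiv ℝ h) x := fun x hx =>
    ((hcd x hx).fderiv_right (m := 0) (by norm_num)).continuousAt
  let D : ℝ → E → ℝ := fun t x => (ContinuousLinearMap.id ℝ E + t • fderiv ℝ h x).det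
  have hDc : ∀ t, ContinuousOn (D t) B := by
    intro t x hx
    have := hcf x hx
    refine ContinuousAt.continuousWithinAt ?_
    exact ContinuousLinearMap.continuous_det.continuousAt.comp (by fun_prop)
  have hpos : ∀ᶠ t in 𝓝 (0 : ℝ), ∀ x ∈ B, 0 < D t x := by
    refine hBc.eventually_forall_of_forall_eventually fun x hx => ?_
    have hc : ContinuousAt (fun z : ℝ × E => D z.1 z.2) (0, x) := by
      have h2 : ContinuousAt (fun z : ℝ × E => fderiv ℝ h z.2) (0, x) :=
        ContinuousAt.comp (f := Prod.snd) (hcf x hx) continuousAt_snd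
      exact ContinuousLinearMap.continuous_det.continuousAt.comp
        (continuousAt_const.add (continuousAt_fst.smul h2))
    have : (0 : ℝ) < D (0, x).1 (0, x).2 := by
      simp [D, ContinuousLinearMap.det]
    exact hc.eventually (lt_mem_nhds this)
  obtain ⟨δ, hδ, hδpos⟩ := Metric.eventually_nhds_iff.1 hpos
  have hvol : ∀ t : ℝ, 0 ≤ t → t ≤ 1 → t * K < 1 → t < δ →
      ∫ x in B, D t x = (volume B).toReal := by
    intro t ht0 ht1 htK htδ
    obtain ⟨hinj, himg⟩ := perturb_bij h K hK h0 (fun x hx => (hr x hx).le) t ht0 ht1 htK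
    have hp := hδpos (y := t) (by simpa [abs_of_nonneg ht0] using htδ)
    have hder : ∀ x ∈ B, HasFDerivWithinAt (fun x => x + t • h x)
        (ContinuousLinearMap.id ℝ E + t • fderiv ℝ h x) B x := by
      intro x hx
      have hd : HasFDerivAt h (fderiv ℝ h x) x :=
        ((hcd x hx).differentiableAt (by norm_num)).hasFDerivAt
      exact ((hasFDerivAt_id x).add (hd.const_smul t)).hasFDerivWithinAt
    have hcv := lintegral_abs_det_fderiv_eq_addHaar_image (volume : Measure E)
      (measurableSet_closedBall : MeasurableSet B) hder hinj
    rw [himg] at hcv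
    rw [← hcv, ← integral_toReal]
    · refine setIntegral_congr_fun measurableSet_closedBall fun x hx => ?_
      rw [ENNReal.toReal_ofReal (abs_nonneg _), abs_of_pos (hp x hx)]
    · exact (((hDc t).aestronglyMeasurable measurableSet_closedBall).aemeasurable.abs).ennreal_ofReal
    · exact Filter.Eventually.of_forall fun x => ENNReal.ofReal_lt_top
  -- interpolation nodes
  obtain ⟨τ, hτ0, hτ1, hτK, hτδ⟩ : ∃ τ : ℝ, 0 < τ ∧ τ ≤ 1 ∧ τ * K < 1 ∧ τ < δ := by
    refine ⟨min (1 / (K + 1)) (δ / 2), by positivity, ?_, ?_, ?_⟩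
    · refine (min_le_left _ _).trans ?_
      rw [div_le_one (by positivity)]
      have := K.2; simp
    · calc min (1 / ((K : ℝ) + 1)) (δ / 2) * K ≤ 1 / (K + 1) * K := by gcongr; exact min_le_left _ _
        _ < 1 := by rw [one_div, inv_mul_lt_iff₀ (by positivity)]; linarith
    · exact (min_le_right _ _).trans_lt (by linarith)
  let s := Finset.range (n + 1)
  let v : ℕ → ℝ := fun i => τ / (i + 1)
  have hvτ : ∀ i, 0 ≤ v i ∧ v i ≤ τ := fun i => ⟨by positivity, by
    apply div_le_self hτ0.le; have : (0:ℝ) ≤ i := by positivity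
    linarith⟩
  have hvi : InjOn v s := by
    intro i _ j _ hij
    have : τ / ((i : ℝ) + 1) = τ / (j + 1) := hij
    rw [div_eq_div_iff (by positivity) (by positivity)] at this
    have := mul_left_cancel₀ hτ0.ne' this
    exact_mod_cast (add_right_cancel this).symm
  have hint : ∀ x, D 1 x = ∑ i ∈ s, D (v i) x * (Lagrange.basis s v i).eval 1 := by
    intro x
    obtain ⟨p, hpd, hp⟩ := exists_det_poly (fderiv ℝ h x)
    have hpi : p = Lagrange.interpolate s v (fun i => p.eval (v i)) := by
      refine Lagrange.eq_interpolate hvi ?_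
      refine (Polynomial.degree_le_natDegree).trans_lt ?_
      simp only [s, Finset.card_range]
      exact_mod_cast Nat.lt_succ_of_le hpd
    have h1 : D 1 x = p.eval 1 := (hp 1).symm
    rw [h1, hpi, Lagrange.interpolate_apply, Polynomial.eval_finsetSum]
    refine Finset.sum_congr rfl fun i _ => ?_
    rw [Polynomial.eval_mul, Polynomial.eval_C, hp]
  have hI1 : ∫ x in B, D 1 x = (volume B).toReal := by
    simp_rw [hint]
    rw [integral_finsetSum]
    · simp_rw [integral_mul_const]
      rw [Finset.sum_congr rfl (g := fun i => (volume B).toReal * (Lagrange.basis s v i).eval 1)]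
      · rw [← Finset.mul_sum, ← Polynomial.eval_finsetSum, Lagrange.sum_basis hvi ⟨0, by simp [s]⟩]
        simp
      · intro i _
        obtain ⟨a, b⟩ := hvτ i
        rw [hvol (v i) a (b.trans hτ1) (lt_of_le_of_lt (by gcongr) hτK) (b.trans_lt hτδ)]
    · intro i _
      exact ((hDc (v i)).integrableOn_compact hBc).mul_const _
  have hI0 : ∫ x in B, D 1 x = 0 := by
    have hae : (B : Set E) =ᵐ[volume] ball 0 1 :=
      (ae_eq_set.2 ⟨by
        rw [show B \ ball 0 1 = sphere 0 1 from closedBall_sdiff_ball]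
        exact Measure.addHaar_sphere_of_ne_zero _ _ one_ne_zero, by
        rw [sdiff_eq_empty.2 ball_subset_closedBall]; simp⟩)
    rw [setIntegral_congr_set hae]
    refine setIntegral_eq_zero_of_forall_eq_zero fun x hx => ?_
    exact det_fderiv_zero U hU h hh hBU hr x (by simpa using hx)
  rw [hI1] at hI0
  have : 0 < (volume B).toReal :=
    ENNReal.toReal_pos (measure_closedBall_pos _ _ one_pos).ne' hBc.measure_lt_top.ne
  linarith

theorem brouwer_smooth (g : E → E) (hg : ContDiff ℝ 1 g) (hgB : ∀ x, ‖g x‖ ≤ 1) :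
    ∃ x, ‖x‖ ≤ 1 ∧ g x = x := by
  by_contra hcon
  push Not at hcon
  have hne : ∀ x, x - g x ≠ 0 := by
    intro x hx
    have : g x = x := (sub_eq_zero.1 hx).symm
    exact hcon x (by rw [← this]; exact hgB x) this
  let w : E → E := fun x => x - g x
  have hw : ContDiff ℝ 1 w := contDiff_id.sub hg
  have hwp : ∀ x, 0 < ‖w x‖ ^ 2 := fun x => by have := norm_pos_iff.2 (hne x); positivity
  let d : E → ℝ := fun x => (inner ℝ x (w x)) ^ 2 + ‖w x‖ ^ 2 * (1 - ‖x‖ ^ 2)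
  have hd : ContDiff ℝ 1 d := by
    exact ((contDiff_id.inner ℝ hw).pow 2).add
      ((hw.norm_sq ℝ).mul (contDiff_const.sub (contDiff_id.norm_sq ℝ)))
  let lam : E → ℝ := fun x => (-(inner ℝ x (w x)) + Real.sqrt (d x)) / ‖w x‖ ^ 2
  have hsph : ∀ x, ‖x‖ = 1 → 0 < inner ℝ x (w x) := by
    intro x hx
    have e1 : ‖w x‖ ^ 2 = ‖x‖ ^ 2 - 2 * inner ℝ x (g x) + ‖g x‖ ^ 2 := norm_sub_sq_real _ _
    have e2 : (inner ℝ x (w x) : ℝ) = ‖x‖ ^ 2 - inner ℝ x (g x) := by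
      simp only [w]; rw [inner_sub_right, real_inner_self_eq_norm_sq]
    have := hwp x
    rw [hx] at e1 e2
    nlinarith [hgB x, norm_nonneg (g x)]
  have hdp : ∀ x, ‖x‖ ≤ 1 → 0 < d x := by
    intro x hx
    rcases hx.lt_or_eq with h | h
    · have : 0 < ‖w x‖ ^ 2 * (1 - ‖x‖ ^ 2) := mul_pos (hwp x) (by nlinarith [norm_nonneg x])
      simp only [d]; positivity
    · simp only [d, h]; have := hsph x h; norm_num; positivity
  refine no_retraction {x | 0 < d x} (isOpen_lt continuous_const hd.continuous)
    (fun x => lam x • w x) ?_ (fun x hx => hdp x (by simpa using hx)) ?_ ?_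
  · refine ContDiffOn.smul (ContDiffOn.div ?_ (hw.norm_sq ℝ).contDiffOn fun x _ => (hwp x).ne')
      hw.contDiffOn
    exact (contDiff_id.inner ℝ hw).neg.contDiffOn.add
      (hd.contDiffOn.sqrt fun x hx => (ne_of_gt hx))
  · intro x hx
    have : lam x = 0 := by
      simp only [lam, d, hx]
      have := hsph x hx
      simp [Real.sqrt_sq this.le]
    simp [this]
  · intro x hx
    have hs := Real.sq_sqrt (hdp x hx).le
    have hl : lam x * ‖w x‖ ^ 2 = -(inner ℝ x (w x)) + Real.sqrt (d x) := by
      simp only [lam]; rw [div_mul_cancel₀ _ (hwp x).ne']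
    have : ‖x + lam x • w x‖ ^ 2 = 1 := by
      rw [norm_add_sq_real, inner_smul_right, norm_smul, mul_pow, Real.norm_eq_abs, sq_abs]
      have hdx : d x = (inner ℝ x (w x)) ^ 2 + ‖w x‖ ^ 2 * (1 - ‖x‖ ^ 2) := rfl
      have hw0 := (hwp x).ne'
      apply mul_left_cancel₀ hw0
      have hs' : (lam x * ‖w x‖ ^ 2 + inner ℝ x (w x)) ^ 2 = d x := by rw [hl]; linear_combination hs
      rw [hdx] at hs'
      linear_combination hs'
    have h3 := norm_nonneg (x + lam x • w x)
    nlinarith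

end

/-- Main Theorem: an `ε`-continuous self-map of the closed unit ball in `ℝⁿ` has an
`ε'`-fixed point for every `ε' > ε / Rₙ`, where `Rₙ = √(2(n+1)/n)`. -/
theorem main_theorem (n : ℕ) (hn : 1 ≤ n) (ε : ℝ) (hε : 0 ≤ ε)
    (f : Metric.closedBall (0 : EuclideanSpace ℝ (Fin n)) 1 →
         Metric.closedBall (0 : EuclideanSpace ℝ (Fin n)) 1)
    (hf : EpsContinuous ε f) (ε' : ℝ)
    (hε' : ε / Real.sqrt (2 * (n + 1) / n) < ε') :
    ∃ x : Metric.closedBall (0 : EuclideanSpace ℝ (Fin n)) 1,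
      ‖(x : EuclideanSpace ℝ (Fin n)) - (f x : EuclideanSpace ℝ (Fin n))‖ ≤ ε' := by
  classical
  choose U hU hfU using hf
  obtain ⟨δ₀, hδ₀, hleb⟩ := lebesgue_number_lemma_of_metric
    (isCompact_univ : IsCompact (univ : Set (closedBall (0 : EuclideanSpace ℝ (Fin n)) 1)))
    (c := fun x => interior (U x)) (fun x => isOpen_interior)
    (fun x _ => mem_iUnion.2 ⟨x, mem_interior_iff_mem_nhds.2 (hU x)⟩)
  set ρ := ε / Real.sqrt (2 * (n + 1) / n) with hρ
  let δ := min δ₀ (ε' - ρ)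
  have hδ : 0 < δ := lt_min hδ₀ (sub_pos.2 hε')
  let S : EuclideanSpace ℝ (Fin n) → Set (EuclideanSpace ℝ (Fin n)) := fun x =>
    {v | ∃ y : closedBall (0 : EuclideanSpace ℝ (Fin n)) 1, dist (y : EuclideanSpace ℝ (Fin n)) x < δ
      ∧ (f y : EuclideanSpace ℝ (Fin n)) = v}
  let t : EuclideanSpace ℝ (Fin n) → Set (EuclideanSpace ℝ (Fin n)) := fun x =>
    if ‖x‖ ≤ 1 then convexHull ℝ (S x) else closedBall 0 1
  have hSB : ∀ x, S x ⊆ closedBall 0 1 := by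
    rintro x v ⟨y, -, rfl⟩; exact (f y).2
  have htB : ∀ x, t x ⊆ closedBall 0 1 := by
    intro x
    by_cases hx : ‖x‖ ≤ 1
    · simp only [t, hx, if_true]
      exact convexHull_min (hSB x) (convex_closedBall _ _)
    · simp only [t, hx, if_false]; exact Subset.rfl
  have htc : ∀ x, Convex ℝ (t x) := by
    intro x
    by_cases hx : ‖x‖ ≤ 1
    · simp only [t, hx, if_true]; exact convex_convexHull _ _
    · simp only [t, hx, if_false]; exact convex_closedBall _ _
  have hloc : ∀ x, ∃ c, ∀ᶠ y in 𝓝 x, c ∈ t y := by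
    intro x
    by_cases hx : ‖x‖ ≤ 1
    · let x' : closedBall (0 : EuclideanSpace ℝ (Fin n)) 1 := ⟨x, by simpa using hx⟩
      refine ⟨f x', ?_⟩
      filter_upwards [ball_mem_nhds x hδ] with y hy
      by_cases hy1 : ‖y‖ ≤ 1
      · simp only [t, hy1, if_true]
        exact subset_convexHull _ _ ⟨x', by rw [dist_comm]; exact hy, rfl⟩
      · simp only [t, hy1, if_false]; exact (f x').2
    · refine ⟨0, ?_⟩
      filter_upwards [(isOpen_lt continuous_const continuous_norm).mem_nhds (not_le.1 hx)] with y hy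
      simp only [t, not_le.2 hy, if_false]; simp
  obtain ⟨g, hg⟩ := exists_contMDiffMap_forall_mem_convex_of_local_const
    (n := 1) (modelWithCornersSelf ℝ (EuclideanSpace ℝ (Fin n))) htc hloc
  have hgs : ContDiff ℝ 1 g := g.contMDiff.contDiff
  obtain ⟨x, hx, hgx⟩ := brouwer_smooth (g : EuclideanSpace ℝ (Fin n) → EuclideanSpace ℝ (Fin n))
    hgs (fun x => by simpa using htB x (hg x))
  have hxm := hg x
  rw [hgx] at hxm
  simp only [t, hx, if_true] at hxm
  have hdiam : ∀ a ∈ S x, ∀ b ∈ S x, dist a b ≤ ε := by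
    rintro _ ⟨a, ha, rfl⟩ _ ⟨b, hb, rfl⟩
    obtain ⟨i, hi⟩ := hleb ⟨x, by simpa using hx⟩ (mem_univ _)
    exact hfU i a (interior_subset (hi (lt_of_lt_of_le ha (min_le_left _ _))))
      b (interior_subset (hi (lt_of_lt_of_le hb (min_le_left _ _))))
  obtain ⟨_, ⟨y, hy, rfl⟩, hs⟩ := jung_point hn (S x) ε hε hdiam x hxm
  refine ⟨y, ?_⟩
  have h1 : dist (y : EuclideanSpace ℝ (Fin n)) x < ε' - ρ := lt_of_lt_of_le hy (min_le_right _ _)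
  rw [dist_eq_norm] at h1
  have := norm_sub_le_norm_sub_add_norm_sub (y : EuclideanSpace ℝ (Fin n)) x (f y)
  linarith
end

section
/- Let n ≥ 1, let C ⊆ ℝⁿ be a compact convex set with nonempty interior, and let A ⊆ C be a subset that contains the topological boundary of C. If A (with the subspace topology) is contractible, then A = C. -/
open Set Filter Topology MeasureTheory Polynomial
open scoped NNReal ENNReal ContDiff

namespace Aux

lemma det_poly {n : ℕ} (L : EuclideanSpace ℝ (Fin n) →L[ℝ] EuclideanSpace ℝ (Fin n)) :
    ∃ p : ℝ[X], p.natDegree ≤ n ∧ ∀ t : ℝ,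
      p.eval t = (ContinuousLinearMap.id ℝ _ + t • L).det := by
  let b := (EuclideanSpace.basisFun (Fin n) ℝ).toBasis
  let M := LinearMap.toMatrix b b (L : EuclideanSpace ℝ (Fin n) →ₗ[ℝ] EuclideanSpace ℝ (Fin n))
  refine ⟨Matrix.det ((X : ℝ[X]) • M.map C + (1 : Matrix (Fin n) (Fin n) ℝ).map C), ?_, ?_⟩
  · simpa using Polynomial.natDegree_det_X_add_C_le M (1 : Matrix (Fin n) (Fin n) ℝ)
  · intro t
    have h1 : (ContinuousLinearMap.id ℝ (EuclideanSpace ℝ (Fin n)) + t • L).det =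
        Matrix.det (1 + t • M) := by
      rw [ContinuousLinearMap.det, ← LinearMap.det_toMatrix b]
      congr 1
      simp [M]
    rw [h1, ← Polynomial.coe_evalRingHom, RingHom.map_det]
    congr 1
    ext i j
    by_cases hij : i = j
    · simp [hij, add_comm]
      exact mul_comm _ _
    · simp [hij]
      exact mul_comm _ _

lemma lagrange_comb (n : ℕ) (ε : ℝ) (hε : 0 < ε) : ∃ (s : Finset ℝ) (w : ℝ → ℝ),
    (∀ t ∈ s, 0 < t ∧ t < ε) ∧ (∑ t ∈ s, w t = 1) ∧
    ∀ p : ℝ[X], p.natDegree ≤ n → p.eval 1 = ∑ t ∈ s, w t * p.eval t := by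
  obtain ⟨s, hs, hcard⟩ := (Set.Ioo_infinite hε).exists_subset_card_eq (n + 1)
  have key : ∀ p : ℝ[X], p.natDegree ≤ n →
      p.eval 1 = ∑ t ∈ s, (Lagrange.basis s id t).eval 1 * p.eval t := by
    intro p hp
    have hd : p.degree < s.card := by
      rw [hcard]
      exact lt_of_le_of_lt p.degree_le_natDegree (by exact_mod_cast Nat.lt_succ_of_le hp)
    have h := Lagrange.eq_interpolate (v := id) (Set.injOn_id _) hd
    conv_lhs => rw [h]
    rw [Lagrange.interpolate_apply, Polynomial.eval_finsetSum]
    refine Finset.sum_congr rfl fun t _ => ?_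
    simp [mul_comm]
  refine ⟨s, fun t => (Lagrange.basis s id t).eval 1, fun t ht => hs ht, ?_, key⟩
  simpa using (key 1 (by simp)).symm

lemma det_pos {n : ℕ} (L : EuclideanSpace ℝ (Fin n) →L[ℝ] EuclideanSpace ℝ (Fin n))
    (t : ℝ) (ht : 0 ≤ t) (h : t * ‖L‖ < 1) :
    0 < (ContinuousLinearMap.id ℝ _ + t • L).det := by
  obtain ⟨p, -, hp⟩ := det_poly L
  have hne : ∀ s ∈ Icc 0 t, p.eval s ≠ 0 := by
    intro s hs h0
    rw [hp] at h0
    have hinj : Function.Injective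
        (ContinuousLinearMap.id ℝ (EuclideanSpace ℝ (Fin n)) + s • L) := by
      rw [injective_iff_map_eq_zero]
      intro v hv
      by_contra hv0
      have hvpos : 0 < ‖v‖ := norm_pos_iff.2 hv0
      have h1 : v = -(s • L v) := by
        have : v + s • L v = 0 := by simpa using hv
        exact eq_neg_of_add_eq_zero_left this
      have h2 : ‖v‖ ≤ s * (‖L‖ * ‖v‖) := by
        conv_lhs => rw [h1]
        rw [norm_neg, norm_smul, Real.norm_of_nonneg hs.1]
        exact mul_le_mul_of_nonneg_left (L.le_opNorm v) hs.1
      have h3 : s * ‖L‖ ≤ t * ‖L‖ := mul_le_mul_of_nonneg_right hs.2 (norm_nonneg _)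
      nlinarith
    have := LinearMap.bot_lt_ker_of_det_eq_zero (f := ((ContinuousLinearMap.id ℝ (EuclideanSpace ℝ (Fin n)) + s • L : _ →L[ℝ] _) : EuclideanSpace ℝ (Fin n) →ₗ[ℝ] EuclideanSpace ℝ (Fin n))) h0
    rw [LinearMap.ker_eq_bot.2 hinj] at this
    exact lt_irrefl _ this
  rw [← hp]
  by_contra hneg
  push Not at hneg
  have h0 : p.eval 0 = 1 := by rw [hp]; simp [ContinuousLinearMap.det]
  obtain ⟨s, hs, hs0⟩ := intermediate_value_Icc' ht (p.continuous.continuousOn (s := Icc 0 t))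
    (show (0:ℝ) ∈ Icc (p.eval t) (p.eval 0) from ⟨hneg, by rw [h0]; norm_num⟩)
  exact hne s hs hs0

/-- extension by zero -/
lemma lip_ext {n : ℕ} {R : ℝ} {K : ℝ≥0} (hR : 0 < R)
    (v : EuclideanSpace ℝ (Fin n) → EuclideanSpace ℝ (Fin n))
    (hv : LipschitzOnWith K v (Metric.closedBall 0 R)) (hv0 : ∀ x, ‖x‖ = R → v x = 0) :
    LipschitzWith K (fun x => if ‖x‖ ≤ R then v x else 0) := by
  have cross : ∀ x y, ‖x‖ ≤ R → R < ‖y‖ → ‖v x‖ ≤ K * ‖x - y‖ := by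
    intro x y hx hy
    have hc : ContinuousOn (fun t : ℝ => ‖x + t • (y - x)‖) (Icc 0 1) := by fun_prop
    obtain ⟨t, ht, hz⟩ := intermediate_value_Icc zero_le_one hc
      (show R ∈ Icc _ _ from ⟨by simpa using hx, by simpa using hy.le⟩)
    have h := hv.norm_sub_le (x := x) (y := x + t • (y - x)) (by simpa using hx)
      (by simpa using le_of_eq hz)
    rw [hv0 _ hz, sub_zero] at h
    refine h.trans (mul_le_mul_of_nonneg_left ?_ K.2)
    rw [show x - (x + t • (y - x)) = t • (x - y) by module, norm_smul, Real.norm_of_nonneg ht.1]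
    exact mul_le_of_le_one_left (norm_nonneg _) ht.2
  refine LipschitzWith.of_dist_le_mul fun x y => ?_
  rw [dist_eq_norm, dist_eq_norm]
  by_cases hx : ‖x‖ ≤ R <;> by_cases hy : ‖y‖ ≤ R <;> simp only [hx, hy, if_true, if_false]
  · exact hv.norm_sub_le (by simpa using hx) (by simpa using hy)
  · simpa using cross x y hx (not_le.1 hy)
  · have := cross y x hy (not_le.1 hx)
    rw [norm_sub_rev y x] at this
    simpa using this
  · simp; positivity

lemma smooth_no_retract {n : ℕ} {R : ℝ} (hR : 0 < R)
    (f : EuclideanSpace ℝ (Fin n) → EuclideanSpace ℝ (Fin n)) (hf : ContDiff ℝ 1 f)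
    (hfR : ∀ x, ‖f x‖ = R) (hfid : ∀ x, ‖x‖ = R → f x = x) : False := by
  let D : (EuclideanSpace ℝ (Fin n)) → ((EuclideanSpace ℝ (Fin n)) →L[ℝ] (EuclideanSpace ℝ (Fin n))) := fun x => fderiv ℝ f x - ContinuousLinearMap.id ℝ (EuclideanSpace ℝ (Fin n))
  have hDc : Continuous D := (hf.continuous_fderiv one_ne_zero).sub continuous_const
  have hdet1 : ∀ x, (ContinuousLinearMap.id ℝ (EuclideanSpace ℝ (Fin n)) + (1:ℝ) • D x).det = 0 := by
    intro x
    have e : ContinuousLinearMap.id ℝ (EuclideanSpace ℝ (Fin n)) + (1:ℝ) • D x = fderiv ℝ f x := by simp [D]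
    rw [e]
    by_contra hdet
    have hsurj : Function.Surjective (fderiv ℝ f x) := by
      have := (LinearMap.equivOfDetNeZero _ hdet).surjective
      exact this
    have hd : HasFDerivAt f (fderiv ℝ f x) x :=
      (hf.differentiable one_ne_zero x).hasFDerivAt
    have h1 := hd.inner ℝ hd
    have h2 : (fun y => inner ℝ (f y) (f y)) = fun _ => R ^ 2 := by
      funext y; rw [real_inner_self_eq_norm_sq, hfR]
    rw [h2] at h1
    have h3 := h1.unique (hasFDerivAt_const _ _)
    obtain ⟨v, hv⟩ := hsurj (f x)
    have h4 := DFunLike.congr_fun h3 v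
    simp [hv, real_inner_self_eq_norm_sq, hfR] at h4
    exact hR.ne' h4
  obtain ⟨K, hK⟩ : ∃ K : ℝ≥0, ∀ x ∈ Metric.closedBall (0:(EuclideanSpace ℝ (Fin n))) R, ‖D x‖₊ ≤ K := by
    obtain ⟨c, hc⟩ := (isCompact_closedBall (0:(EuclideanSpace ℝ (Fin n))) R).exists_bound_of_continuousOn hDc.continuousOn
    exact ⟨c.toNNReal, fun x hx => by
      rw [← NNReal.coe_le_coe]; exact (hc x hx).trans (Real.le_coe_toNNReal c)⟩
  have hvd : ∀ x, HasFDerivAt (fun x => f x - x) (D x) x := fun x =>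
    ((hf.differentiable one_ne_zero x).hasFDerivAt).sub (hasFDerivAt_id x)
  have hlip : LipschitzOnWith K (fun x => f x - x) (Metric.closedBall 0 R) :=
    (convex_closedBall (0:(EuclideanSpace ℝ (Fin n))) R).lipschitzOnWith_of_nnnorm_hasFDerivWithin_le
      (fun x _ => (hvd x).hasFDerivWithinAt) hK
  have hu := lip_ext hR _ hlip (fun x hx => by simp [hfid x hx])
  set u : (EuclideanSpace ℝ (Fin n)) → (EuclideanSpace ℝ (Fin n)) := fun x => if ‖x‖ ≤ R then f x - x else 0 with hudef
  have hu0 : ∀ x, R ≤ ‖x‖ → u x = 0 := by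
    intro x hx
    rcases hx.eq_or_lt with h | h
    · simp [u, hfid x h.symm]
    · simp [u, not_le.2 h]
  have hfn : (0:ℝ) < 1 / (K + 1) := by positivity
  obtain ⟨s, w, hs, hw, hp⟩ := lagrange_comb n (1 / (K + 1)) hfn
  have hcont : ∀ t : ℝ, Continuous fun x => (ContinuousLinearMap.id ℝ (EuclideanSpace ℝ (Fin n)) + t • D x).det := by
    intro t
    exact ContinuousLinearMap.continuous_det.comp (continuous_const.add (hDc.const_smul t))
  have hint : ∀ t : ℝ, IntegrableOn (fun x => (ContinuousLinearMap.id ℝ (EuclideanSpace ℝ (Fin n)) + t • D x).det)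
      (Metric.ball 0 R) := fun t =>
    ((hcont t).continuousOn.integrableOn_compact (isCompact_closedBall (0:(EuclideanSpace ℝ (Fin n))) R)).mono_set
      Metric.ball_subset_closedBall
  have hvol : ∀ t ∈ s, ∫ x in Metric.ball (0:(EuclideanSpace ℝ (Fin n))) R,
      (ContinuousLinearMap.id ℝ (EuclideanSpace ℝ (Fin n)) + t • D x).det = volume.real (Metric.ball (0:(EuclideanSpace ℝ (Fin n))) R) := by
    intro t ht
    obtain ⟨ht0, ht1⟩ := hs t ht
    have htK : t * K < 1 := by
      rw [lt_div_iff₀ (by positivity)] at ht1; nlinarith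
    let h : (EuclideanSpace ℝ (Fin n)) → (EuclideanSpace ℝ (Fin n)) := fun x => x + t • u x
    have hnormu : ∀ x y, ‖u x - u y‖ ≤ K * ‖x - y‖ := fun x y => by
      simpa [dist_eq_norm] using hu.dist_le_mul x y
    have hinj : Function.Injective h := by
      intro x y hxy
      by_contra hne
      have hpos : 0 < ‖x - y‖ := norm_pos_iff.2 (sub_ne_zero.2 hne)
      have e : x - y = -(t • (u x - u y)) := by
        have : x + t • u x = y + t • u y := hxy
        have e2 : x - y = t • u y - t • u x := by rw [sub_eq_sub_iff_add_eq_add, this]; abel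
        rw [e2]; module
      have h2 : ‖x - y‖ ≤ t * (K * ‖x - y‖) := by
        conv_lhs => rw [e]
        rw [norm_neg, norm_smul, Real.norm_of_nonneg ht0.le]
        exact mul_le_mul_of_nonneg_left (hnormu x y) ht0.le
      nlinarith
    have hsurj : Function.Surjective h := by
      intro y
      have hc : ContractingWith (t.toNNReal * K) (fun x => y - t • u x) := by
        refine ⟨?_, LipschitzWith.of_dist_le_mul fun a b => ?_⟩
        · rw [← NNReal.coe_lt_coe]; simpa [ht0.le] using htK
        · rw [dist_eq_norm, dist_eq_norm,
            show y - t • u a - (y - t • u b) = -(t • (u a - u b)) by module, norm_neg, norm_smul,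
            Real.norm_of_nonneg ht0.le]
          have := mul_le_mul_of_nonneg_left (hnormu a b) ht0.le
          simpa [ht0.le, mul_assoc] using this
      refine ⟨hc.fixedPoint, ?_⟩
      have := hc.fixedPoint_isFixedPt
      have e : y - t • u hc.fixedPoint = hc.fixedPoint := this
      change hc.fixedPoint + t • u hc.fixedPoint = y
      nth_rewrite 1 [← e]
      abel
    have hout : ∀ x, R ≤ ‖x‖ → h x = x := fun x hx => by simp [h, hu0 x hx]
    have himg : h '' Metric.ball 0 R = Metric.ball 0 R := by
      ext y
      constructor
      · rintro ⟨x, hx, rfl⟩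
        by_contra hy
        have hy' : R ≤ ‖h x‖ := by simpa using hy
        have := hinj (hout _ hy')
        rw [this] at hy
        exact hy hx
      · intro hy
        obtain ⟨x, rfl⟩ := hsurj y
        refine ⟨x, ?_, rfl⟩
        by_contra hx
        rw [hout x (by simpa using hx)] at hy
        exact hx hy
    have hder : ∀ x ∈ Metric.ball (0:(EuclideanSpace ℝ (Fin n))) R,
        HasFDerivWithinAt h (ContinuousLinearMap.id ℝ (EuclideanSpace ℝ (Fin n)) + t • D x) (Metric.ball 0 R) x := by
      intro x hx
      have h1 : HasFDerivAt (fun x => x + t • (f x - x))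
          (ContinuousLinearMap.id ℝ (EuclideanSpace ℝ (Fin n)) + t • D x) x :=
        (hasFDerivAt_id x).add ((hvd x).const_smul t)
      refine h1.hasFDerivWithinAt.congr (fun y hy => ?_) ?_
      · have : ‖y‖ ≤ R := by simpa using (mem_ball_zero_iff.1 hy).le
        simp [h, u, this]
      · have : ‖x‖ ≤ R := by simpa using (mem_ball_zero_iff.1 hx).le
        simp [h, u, this]
    have key := integral_image_eq_integral_abs_det_fderiv_smul volume
      (Metric.isOpen_ball.measurableSet) hder hinj.injOn (fun _ => (1:ℝ))
    rw [himg] at key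
    simp only [smul_eq_mul, mul_one] at key
    rw [setIntegral_const, smul_eq_mul, mul_one] at key
    rw [key]
    refine setIntegral_congr_fun Metric.isOpen_ball.measurableSet fun x hx => ?_
    refine (abs_of_pos (det_pos _ t ht0.le ?_)).symm
    have : ‖D x‖ ≤ K := hK x (Metric.ball_subset_closedBall hx)
    exact (mul_le_mul_of_nonneg_left this ht0.le).trans_lt htK
  have hcomb : ∀ x, (0:ℝ) = ∑ t ∈ s, w t * (ContinuousLinearMap.id ℝ (EuclideanSpace ℝ (Fin n)) + t • D x).det := by
    intro x
    obtain ⟨p, hpd, hpe⟩ := det_poly (D x)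
    have := hp p hpd
    rw [hpe, hdet1] at this
    simpa only [hpe] using this
  have h0 : (0:ℝ) = ∫ x in Metric.ball (0:(EuclideanSpace ℝ (Fin n))) R,
      ∑ t ∈ s, w t * (ContinuousLinearMap.id ℝ (EuclideanSpace ℝ (Fin n)) + t • D x).det := by
    simp only [← hcomb, integral_zero]
  rw [integral_finset_sum _ (fun t _ => (hint t).const_mul _)] at h0
  simp only [integral_const_mul] at h0
  rw [Finset.sum_congr rfl (fun t ht => by rw [hvol t ht]), ← Finset.sum_mul, hw, one_mul] at h0
  have hpos : 0 < volume.real (Metric.ball (0:(EuclideanSpace ℝ (Fin n))) R) :=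
    ENNReal.toReal_pos (Metric.measure_ball_pos _ _ hR).ne' measure_ball_lt_top.ne
  exact hpos.ne h0

lemma no_retract {n : ℕ} {R : ℝ} (hR : 0 < R)
    (G : EuclideanSpace ℝ (Fin n) → EuclideanSpace ℝ (Fin n)) (hG : Continuous G)
    (hG0 : ∀ x, G x ≠ 0) (hGid : ∀ x, R ≤ ‖x‖ → G x = x) : False := by
  obtain ⟨g, hg, hgd, hgS, -⟩ := hG.exists_contDiff_approx_and_eqOn (ε := fun x => ‖G x‖) 1
    (by fun_prop) (fun x => norm_pos_iff.2 (hG0 x))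
    (S := {x | R + 1 ≤ ‖x‖}) (U := {x | R < ‖x‖})
    (isClosed_le continuous_const continuous_norm)
    ((isOpen_lt continuous_const continuous_norm).mem_nhdsSet.2 (fun x hx => by
      simp only [mem_ofPred_eq] at *; linarith))
    (contDiffOn_id.congr (fun x hx => hGid x (le_of_lt hx)))
  have hg0 : ∀ x, g x ≠ 0 := by
    intro x hx
    have := hgd x
    simp [hx, dist_eq_norm] at this
  have hR1 : 0 < R + 1 := by linarith
  refine smooth_no_retract hR1 (fun x => ((R + 1) / ‖g x‖) • g x) ?_ ?_ ?_
  · exact (contDiff_const.div (hg.norm ℝ hg0) (fun x => norm_ne_zero_iff.2 (hg0 x))).smul hg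
  · intro x
    have := norm_pos_iff.2 (hg0 x)
    rw [norm_smul, Real.norm_of_nonneg (by positivity)]
    field_simp
  · intro x hx
    have e : g x = x := (hgS (show R + 1 ≤ ‖x‖ from hx.ge)).trans (hGid x (by linarith))
    simp only [e, hx]
    rw [div_self hR1.ne', one_smul]

end Aux

open Aux in
theorem eq_of_contractible_contains_frontier (n : ℕ) (hn : 1 ≤ n)
    (C : Set (EuclideanSpace ℝ (Fin n))) (hCcomp : IsCompact C) (hCconv : Convex ℝ C)
    (hCint : (interior C).Nonempty) (A : Set (EuclideanSpace ℝ (Fin n)))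
    (hAC : A ⊆ C) (hfr : frontier C ⊆ A) (hA : ContractibleSpace A) :
    A = C := by
  refine hAC.antisymm fun p hpC => ?_
  by_contra hpA
  have hpint : p ∈ interior C := by
    by_contra h
    exact hpA (hfr ⟨subset_closure hpC, h⟩)
  obtain ⟨a0, ⟨H⟩⟩ := id_nullhomotopic A
  -- extended homotopy
  obtain ⟨Φ, hΦc, hΦA, hΦ0, hΦ1⟩ : ∃ Φ : EuclideanSpace ℝ (Fin n) × ℝ → EuclideanSpace ℝ (Fin n),
      ContinuousOn Φ (A ×ˢ univ) ∧ (∀ x ∈ A, ∀ t, Φ (x, t) ∈ A) ∧ (∀ x ∈ A, Φ (x, 0) = x) ∧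
      (∀ x ∈ A, Φ (x, 1) = a0) := by
    classical
    refine ⟨fun q => if h : q.1 ∈ A then H (projIcc 0 1 zero_le_one q.2, ⟨q.1, h⟩) else 0,
      ?_, ?_, ?_, ?_⟩
    · rw [continuousOn_iff_continuous_restrict]
      have : Continuous fun q : (A ×ˢ (univ : Set ℝ) : Set _) =>
          ((H (projIcc 0 1 zero_le_one q.1.2, ⟨q.1.1, q.2.1⟩) : A) : EuclideanSpace ℝ (Fin n)) := by
        refine continuous_subtype_val.comp (H.continuous.comp ?_)
        exact (continuous_projIcc.comp (by fun_prop)).prodMk (by fun_prop)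
      refine this.congr fun q => ?_
      have hq : q.1.1 ∈ A := q.2.1
      simp [hq]
    · intro x hx t
      simp [hx]
    · intro x hx
      have : projIcc (0:ℝ) 1 zero_le_one 0 = 0 := projIcc_left _
      simp [hx, this]
    · intro x hx
      have : projIcc (0:ℝ) 1 zero_le_one 1 = 1 := projIcc_right _
      simp [hx, this]
  let D : Set (EuclideanSpace ℝ (Fin n)) := (fun x => p + x) ⁻¹' C
  have hDconv : Convex ℝ D := hCconv.translate_preimage_right p
  have hD0 : D ∈ 𝓝 (0 : EuclideanSpace ℝ (Fin n)) := by
    refine (by fun_prop : Continuous fun x => p + x).continuousAt.preimage_mem_nhds ?_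
    simpa using mem_interior_iff_mem_nhds.1 hpint
  let g := gauge D
  have hgc : Continuous g := continuous_gauge hDconv hD0
  have hfrD : ∀ x, g x = 1 → p + x ∈ A := by
    intro x hx
    have h1 : x ∈ frontier D := (gauge_eq_one_iff_mem_frontier hDconv hD0).1 hx
    refine hfr ?_
    have : frontier D = (Homeomorph.addLeft p) ⁻¹' frontier C :=
      ((Homeomorph.addLeft p).preimage_frontier C).symm
    rw [this] at h1
    exact h1
  have hproj : ∀ x, 0 < g x → p + (g x)⁻¹ • x ∈ A := by
    intro x hx
    apply hfrD
    change gauge D _ = 1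
    rw [gauge_smul_of_nonneg (inv_nonneg.2 hx.le), smul_eq_mul]
    exact inv_mul_cancel₀ hx.ne'
  obtain ⟨R, hR, hRD⟩ : ∃ R : ℝ, 0 < R ∧ ∀ x, R ≤ ‖x‖ → 1 ≤ g x := by
    obtain ⟨r, hr⟩ := hCcomp.isBounded.exists_norm_le
    refine ⟨|r| + ‖p‖ + 1, by positivity, fun x hx => ?_⟩
    by_contra hlt
    have h1 : x ∈ D := interior_subset ((gauge_lt_one_iff_mem_interior hDconv hD0).1 (not_le.1 hlt))
    have h2 := hr _ h1
    have h3 : ‖x‖ ≤ ‖p + x‖ + ‖p‖ := by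
      simpa using norm_sub_le (p + x) p
    have := le_abs_self r
    linarith
  classical
  let mid : EuclideanSpace ℝ (Fin n) → EuclideanSpace ℝ (Fin n) :=
    fun x => Φ (p + (g x)⁻¹ • x, 2 - 2 * g x) - p
  have hmidc : ContinuousOn mid {x | 1 / 2 ≤ g x} := by
    refine (hΦc.comp (f := fun x => (p + (g x)⁻¹ • x, 2 - 2 * g x)) ?_ ?_).sub continuousOn_const
    · refine ContinuousOn.prodMk ?_ (by fun_prop)
      refine continuousOn_const.add (ContinuousOn.smul (hgc.continuousOn.inv₀ ?_) continuousOn_id)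
      intro x hx
      have : 1 / 2 ≤ g x := hx
      linarith
    · intro x hx
      have : 1 / 2 ≤ g x := hx
      exact ⟨hproj x (by linarith), mem_univ _⟩
  let inn : EuclideanSpace ℝ (Fin n) → EuclideanSpace ℝ (Fin n) :=
    fun x => if 1 / 2 ≤ g x then mid x else a0 - p
  have hinnc : Continuous inn := by
    refine continuous_if_le continuous_const hgc hmidc continuousOn_const fun x hx => ?_
    simp only [mid]
    rw [show 2 - 2 * g x = 1 by rw [← hx]; norm_num, hΦ1 _ (hproj x (by rw [← hx]; norm_num))]
  have hne : ∀ a ∈ A, a - p ≠ 0 := fun a ha h => hpA (sub_eq_zero.1 h ▸ ha)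
  refine no_retract hR (fun x => if 1 ≤ g x then x else inn x) ?_ ?_ ?_
  · refine continuous_if_le continuous_const hgc continuousOn_id hinnc.continuousOn fun x hx => ?_
    have h1 : p + x ∈ A := hfrD x hx.symm
    have : (1:ℝ) / 2 ≤ g x := by rw [← hx]; norm_num
    simp only [inn, mid, this, if_true]
    rw [← hx]
    simp [hΦ0 _ h1]
  · intro x
    by_cases h1 : 1 ≤ g x
    · simp only [h1, if_true]
      rintro rfl
      simp [g] at h1
      linarith
    · simp only [h1, if_false, inn]
      split_ifs with h2
      · exact hne _ (hΦA _ (hproj x (by linarith)) _)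
      · exact hne _ a0.2
  · intro x hx
    simp [hRD x hx]
end

section
/- Let n ≥ 1 and let Bⁿ denote the closed unit ball in n-dimensional Euclidean space. If f : Bⁿ → Bⁿ is ε-continuous for some ε ≥ 0, then for every ε' > ε/√2 there exists x ∈ Bⁿ with ‖x − f(x)‖ ≤ ε'. -/
open MeasureTheory Metric Set

theorem sqrt_two_convex {E : Type*} [NormedAddCommGroup E] [InnerProductSpace ℝ E]
    {S : Set E} {ε : ℝ} (hε : 0 ≤ ε) (hS : ∀ a ∈ S, ∀ b ∈ S, dist a b ≤ ε) {y : E}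
    (hy : y ∈ convexHull ℝ S) : ∃ s ∈ S, ‖y - s‖ ≤ ε / Real.sqrt 2 := by
  rw [mem_convexHull_iff_exists_fintype] at hy
  obtain ⟨ι, _, w, z, hw0, hw1, hz, rfl⟩ := hy
  set y := ∑ i, w i • z i with hy
  by_contra! hcon
  have hsq : ∀ i, ε ^ 2 / 2 < ‖y - z i‖ ^ 2 := by
    intro i
    have h1 := hcon (z i) (hz i)
    have h2 : (ε / Real.sqrt 2) ^ 2 = ε ^ 2 / 2 := by
      rw [div_pow, Real.sq_sqrt (by norm_num)]
    rw [← h2]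
    exact pow_lt_pow_left₀ h1 (by positivity) (by norm_num)
  have hne : Nonempty ι := by
    by_contra h
    rw [not_nonempty_iff] at h
    simp at hw1
  obtain ⟨j⟩ := hne
  have hid : ∑ i, w i * ‖z j - z i‖ ^ 2 = ‖y - z j‖ ^ 2 + ∑ i, w i * ‖y - z i‖ ^ 2 := by
    have h1 : ∀ i, w i * ‖z j - z i‖ ^ 2 = w i * ‖y - z j‖ ^ 2 + w i * ‖y - z i‖ ^ 2
        - 2 * inner ℝ (y - z j) (w i • (y - z i)) := by
      intro i
      have : z j - z i = (y - z i) - (y - z j) := by abel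
      rw [this, norm_sub_sq_real, inner_smul_right, real_inner_comm]
      ring
    simp_rw [h1]
    rw [Finset.sum_sub_distrib, Finset.sum_add_distrib, ← Finset.sum_mul, hw1, ← Finset.mul_sum,
      ← inner_sum]
    have : ∑ i, w i • (y - z i) = 0 := by
      simp_rw [smul_sub]
      rw [Finset.sum_sub_distrib, ← Finset.sum_smul, hw1, one_smul, ← hy, sub_self]
    rw [this]; simp
  have hle : ∑ i, w i * ‖z j - z i‖ ^ 2 ≤ ε ^ 2 := by
    calc _ ≤ ∑ i, w i * ε ^ 2 := by
          gcongr with i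
          · exact hw0 i
          · rw [← dist_eq_norm]; exact hS _ (hz j) _ (hz i)
      _ = _ := by rw [← Finset.sum_mul, hw1, one_mul]
  have hge : ε ^ 2 / 2 ≤ ∑ i, w i * ‖y - z i‖ ^ 2 := by
    calc _ = ∑ i, w i * (ε ^ 2 / 2) := by rw [← Finset.sum_mul, hw1, one_mul]
      _ ≤ _ := by
        gcongr with i
        · exact hw0 i
        · exact (hsq i).le
  linarith [hsq j]

/-- `det (1 + t A)` is a polynomial in `t` of degree at most `n`, via interpolation. -/
theorem det_interp {n : ℕ} (v : ℕ → ℝ) (hv : Set.InjOn v (Finset.range (n + 1)))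
    (A : EuclideanSpace ℝ (Fin n) →L[ℝ] EuclideanSpace ℝ (Fin n)) (t : ℝ) :
    (1 + t • A).det = ∑ i ∈ Finset.range (n + 1),
      (1 + v i • A).det * (Lagrange.basis (Finset.range (n + 1)) v i).eval t := by
  let b := (EuclideanSpace.basisFun (Fin n) ℝ).toBasis
  let M := LinearMap.toMatrix b b (A : EuclideanSpace ℝ (Fin n) →ₗ[ℝ] EuclideanSpace ℝ (Fin n))
  let p : Polynomial ℝ := Matrix.det ((Polynomial.X : Polynomial ℝ) • M.map Polynomial.C
    + (1 : Matrix (Fin n) (Fin n) ℝ).map Polynomial.C)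
  have hp : ∀ s : ℝ, p.eval s = (1 + s • A).det := by
    intro s
    have h1 : (1 + s • A).det = Matrix.det (1 + s • M) := by
      rw [ContinuousLinearMap.det, ← LinearMap.det_toMatrix b]
      congr 1
      simp [M, LinearMap.toMatrix_one]
    rw [h1, ← Polynomial.coe_evalRingHom, RingHom.map_det]
    congr 1
    ext i j
    simp only [RingHom.mapMatrix_apply, Matrix.map_apply, Matrix.add_apply, Matrix.smul_apply,
      smul_eq_mul, Polynomial.coe_evalRingHom, Polynomial.eval_add, Polynomial.eval_mul,
      Polynomial.eval_X, Polynomial.eval_C]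
    ring
  have hd : p.degree < (Finset.range (n + 1)).card := by
    have := Polynomial.natDegree_det_X_add_C_le M 1
    rw [Fintype.card_fin] at this
    rw [Finset.card_range]
    exact lt_of_le_of_lt Polynomial.degree_le_natDegree (by exact_mod_cast Nat.lt_succ_of_le this)
  have := congrArg (Polynomial.eval t) (Lagrange.eq_interpolate (f := p) hv hd)
  rw [hp, Lagrange.interpolate_apply, Polynomial.eval_finsetSum] at this
  simpa [hp] using this
theorem no_retract {n : ℕ} (h : EuclideanSpace ℝ (Fin n) → EuclideanSpace ℝ (Fin n))
    (hC : ∀ x, ‖x‖ ≤ 1 → ContDiffAt ℝ 1 h x)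
    (h0 : ∀ x, ‖x‖ = 1 → h x = 0) (h1 : ∀ x, ‖x‖ ≤ 1 → ‖x + h x‖ = 1) : False := by
  have hcont : ContinuousOn (fderiv ℝ h) (closedBall 0 1) := fun x hx =>
    ((hC x (by simpa using hx)).fderiv_right (m := 0) (by simp)).continuousAt.continuousWithinAt
  have hdiff : ∀ x, ‖x‖ ≤ 1 → DifferentiableAt ℝ h x := fun x hx =>
    (hC x hx).differentiableAt (by simp)
  obtain ⟨K₀, hK₀⟩ := (isCompact_closedBall (0 : EuclideanSpace ℝ (Fin n)) 1).exists_bound_of_continuousOn hcont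
  set K := max K₀ 1 with hK
  have hK1 : 1 ≤ K := le_max_right _ _
  have hbd : ∀ x, ‖x‖ ≤ 1 → ‖fderiv ℝ h x‖ ≤ K := fun x hx =>
    (hK₀ x (by simpa using hx)).trans (le_max_left _ _)
  have hlip : ∀ x y, ‖x‖ ≤ 1 → ‖y‖ ≤ 1 → ‖h x - h y‖ ≤ K * ‖x - y‖ := by
    intro x y hx hy
    exact Convex.norm_image_sub_le_of_norm_fderiv_le (𝕜 := ℝ) (s := closedBall 0 1)
      (fun z hz => hdiff z (by simpa using hz)) (fun z hz => hbd z (by simpa using hz))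
      (convex_closedBall _ _) (by simpa using hy) (by simpa using hx)
  have hbdry : ∀ x, ‖x‖ ≤ 1 → ‖h x‖ ≤ K * (1 - ‖x‖) := by
    intro x hx
    by_cases hx0 : x = 0
    · subst hx0
      have := h1 0 (by simp)
      rw [zero_add] at this
      simpa [this] using hK1
    · have hxp : 0 < ‖x‖ := norm_pos_iff.mpr hx0
      have hz : ‖‖x‖⁻¹ • x‖ = 1 := by
        rw [norm_smul, norm_inv, norm_norm, inv_mul_cancel₀ hxp.ne']
      have h2 := hlip x (‖x‖⁻¹ • x) hx hz.le
      rw [h0 _ hz, sub_zero] at h2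
      have h3 : ‖x - ‖x‖⁻¹ • x‖ = 1 - ‖x‖ := by
        have : x - ‖x‖⁻¹ • x = (1 - ‖x‖⁻¹) • x := by rw [sub_smul, one_smul]
        rw [this, norm_smul, Real.norm_eq_abs, abs_of_nonpos, neg_sub, sub_mul, one_mul,
          inv_mul_cancel₀ hxp.ne']
        linarith [(one_le_inv₀ hxp).mpr hx]
      rwa [h3] at h2
  classical
  -- extension by zero
  let H : EuclideanSpace ℝ (Fin n) → EuclideanSpace ℝ (Fin n) := fun x => if ‖x‖ ≤ 1 then h x else 0
  have hHaux : ∀ x y, ‖x‖ ≤ 1 → ¬ ‖y‖ ≤ 1 → ‖h x‖ ≤ K * ‖x - y‖ := by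
    intro x y hx hy
    refine (hbdry x hx).trans ?_
    gcongr
    have := norm_sub_norm_le y x
    rw [norm_sub_rev] at this
    linarith
  have hHlip : ∀ x y, ‖H x - H y‖ ≤ K * ‖x - y‖ := by
    intro x y
    by_cases hx : ‖x‖ ≤ 1 <;> by_cases hy : ‖y‖ ≤ 1
    · simp only [H, hx, hy, if_true]; exact hlip x y hx hy
    · simp only [H, hx, hy, if_true, if_false, sub_zero]; exact hHaux x y hx hy
    · simp only [H, hx, hy, if_true, if_false, zero_sub, norm_neg]
      rw [norm_sub_rev]; exact hHaux y x hy hx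
    · simp only [H, hx, hy, if_false, sub_zero, norm_zero]; positivity
  -- positivity of the determinant near the identity
  obtain ⟨ρ, hρ, hdet⟩ : ∃ ρ > 0, ∀ A : EuclideanSpace ℝ (Fin n) →L[ℝ] EuclideanSpace ℝ (Fin n),
      ‖A‖ < ρ → 0 < (1 + A).det := by
    have hc : Continuous fun A : EuclideanSpace ℝ (Fin n) →L[ℝ] EuclideanSpace ℝ (Fin n) =>
        (1 + A).det := ContinuousLinearMap.continuous_det.comp (by fun_prop)
    have hev : ∀ᶠ A in nhds (0 : EuclideanSpace ℝ (Fin n) →L[ℝ] EuclideanSpace ℝ (Fin n)),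
        0 < (1 + A).det := by
      apply hc.continuousAt.eventually_const_lt
      simp [ContinuousLinearMap.det]
    obtain ⟨ρ, hρ, hb⟩ := Metric.eventually_nhds_iff.mp hev
    exact ⟨ρ, hρ, fun A hA => hb (by simpa using hA)⟩
  obtain ⟨τ, hτ, hτ1, hτK, hτρ⟩ : ∃ τ > 0, τ < 1 ∧ τ * K < 1 ∧ τ * K < ρ := by
    refine ⟨min (1/2) (ρ/2) / K, by positivity, ?_, ?_, ?_⟩
    · rw [div_lt_one (by positivity)]
      exact (min_le_left _ _).trans_lt (by linarith)
    · rw [div_mul_cancel₀ _ (by positivity)]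
      exact (min_le_left _ _).trans_lt (by norm_num)
    · rw [div_mul_cancel₀ _ (by positivity)]
      exact (min_le_right _ _).trans_lt (by linarith)
  let μ : Measure (EuclideanSpace ℝ (Fin n)) := volume
  let B : Set (EuclideanSpace ℝ (Fin n)) := ball 0 1
  have hkey : ∀ t, 0 < t → t ≤ τ → ∫ x in B, (1 + t • fderiv ℝ h x).det ∂μ = μ.real B := by
    intro t ht htτ
    have htK : t * K < 1 := lt_of_le_of_lt (by gcongr) hτK
    have hinj : InjOn (fun x => x + t • h x) B := by
      intro x hx y hy hxy
      have hx' : ‖x‖ < 1 := by simpa [B] using hx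
      have hy' : ‖y‖ < 1 := by simpa [B] using hy
      have e : x - y = t • (h y - h x) := by
        simp only at hxy
        rw [smul_sub, sub_eq_sub_iff_add_eq_add, hxy]; abel
      have h2 : ‖x - y‖ ≤ t * K * ‖x - y‖ := by
        calc ‖x - y‖ = t * ‖h y - h x‖ := by
              conv_lhs => rw [e]
              rw [norm_smul, Real.norm_of_nonneg ht.le]
          _ ≤ t * (K * ‖y - x‖) := by gcongr; exact hlip y x hy'.le hx'.le
          _ = _ := by rw [norm_sub_rev]; ring
      have h3 : ‖x - y‖ = 0 := by nlinarith [norm_nonneg (x - y)]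
      exact sub_eq_zero.mp (norm_eq_zero.mp h3)
    have himg : (fun x => x + t • h x) '' B = B := by
      apply Subset.antisymm
      · rintro _ ⟨x, hx, rfl⟩
        have hx' : ‖x‖ < 1 := by simpa [B] using hx
        have e : x + t • h x = (1 - t) • x + t • (x + h x) := by module
        have : ‖x + t • h x‖ < 1 := by
          rw [e]
          refine (norm_add_le _ _).trans_lt ?_
          rw [norm_smul, norm_smul, h1 x hx'.le, Real.norm_of_nonneg ht.le,
            Real.norm_of_nonneg (by linarith)]
          nlinarith
        simpa [B] using this
      · intro y hy
        have hy' : ‖y‖ < 1 := by simpa [B] using hy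
        have hcw : ContractingWith (Real.toNNReal (t * K)) (fun x => y - t • H x) := by
          refine ⟨by simpa using htK, LipschitzWith.of_dist_le_mul fun a b => ?_⟩
          rw [dist_eq_norm, dist_eq_norm]
          have e : y - t • H a - (y - t • H b) = t • (H b - H a) := by module
          rw [e, norm_smul, Real.norm_of_nonneg ht.le, norm_sub_rev a b,
            Real.coe_toNNReal _ (by positivity), mul_assoc]
          gcongr
          exact hHlip b a
        have hfix := hcw.fixedPoint_isFixedPt
        set x := hcw.fixedPoint
        have hfx : y - t • H x = x := hfix
        have hx : ‖x‖ < 1 := by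
          by_contra hx
          have : H x = 0 := by
            by_cases hx2 : ‖x‖ ≤ 1
            · simp only [H, hx2, if_true]
              exact h0 x (le_antisymm hx2 (not_lt.mp hx))
            · simp only [H, hx2, if_false]
          rw [this, smul_zero, sub_zero] at hfx
          rw [← hfx] at hx
          exact hx hy'
        refine ⟨x, by simpa [B] using hx, ?_⟩
        have : H x = h x := by simp only [H, hx.le, if_true]
        rw [this] at hfx
        simp only
        rw [← sub_eq_iff_eq_add.mp hfx]
    have hcv := integral_image_eq_integral_abs_det_fderiv_smul μ (s := B)
      (f := fun x => x + t • h x) (f' := fun x => 1 + t • fderiv ℝ h x) measurableSet_ball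
      (fun x hx => by
        have hx' : ‖x‖ < 1 := by simpa [B] using hx
        exact ((hasFDerivAt_id x).add
          ((hdiff x hx'.le).hasFDerivAt.const_smul t)).hasFDerivWithinAt) hinj (fun _ => (1 : ℝ))
    rw [himg] at hcv
    simp only [integral_const, smul_eq_mul, mul_one, measureReal_restrict_apply_univ] at hcv
    rw [hcv]
    refine setIntegral_congr_fun measurableSet_ball fun x hx => ?_
    have hx' : ‖x‖ < 1 := by simpa [B] using hx
    refine (abs_of_pos (hdet _ ?_)).symm
    rw [norm_smul, Real.norm_of_nonneg ht.le]
    refine lt_of_le_of_lt ?_ hτρ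
    gcongr
    exact hbd x hx'.le
  have hzero : ∀ x ∈ B, (1 + (1 : ℝ) • fderiv ℝ h x).det = 0 := by
    intro x hx
    have hx' : ‖x‖ < 1 := by simpa [B] using hx
    rw [one_smul]
    by_contra hne
    set D : EuclideanSpace ℝ (Fin n) →L[ℝ] EuclideanSpace ℝ (Fin n) := 1 + fderiv ℝ h x with hD
    have hder : HasFDerivAt (fun x => x + h x) D x :=
      (hasFDerivAt_id x).add (hdiff x hx'.le).hasFDerivAt
    have hn := hder.norm_sq
    have hconst : (fun y => ‖y + h y‖ ^ 2) =ᶠ[nhds x] fun _ => (1 : ℝ) := by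
      filter_upwards [isOpen_ball.mem_nhds hx] with y hy
      have hy' : ‖y‖ < 1 := by simpa [B] using hy
      rw [h1 y hy'.le]; norm_num
    have hz := hn.unique ((hasFDerivAt_const (1 : ℝ) x).congr_of_eventuallyEq hconst)
    obtain ⟨v, hv⟩ : ∃ v, D v = x + h x := by
      have hu : IsUnit (D : EuclideanSpace ℝ (Fin n) →ₗ[ℝ] EuclideanSpace ℝ (Fin n)) :=
        (LinearMap.isUnit_iff_isUnit_det _).mpr (isUnit_iff_ne_zero.mpr hne)
      exact ((Module.End.isUnit_iff _).mp hu).2 (x + h x)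
    have h3 := congrArg (fun L => L v) hz
    have h4 : (2 : ℝ) * inner ℝ (x + h x) (x + h x) = 0 := by
      have h5 : (2 : ℝ) * inner ℝ x (x + h x) + 2 * inner ℝ (h x) (x + h x) = 0 := by
        simpa [hv] using h3
      rw [inner_add_left (x := x) (y := h x)]
      linarith
    rw [real_inner_self_eq_norm_sq, h1 x hx'.le] at h4
    norm_num at h4
  let v : ℕ → ℝ := fun i => τ / (i + 1)
  have hv : InjOn v (Finset.range (n + 1)) := by
    intro i _ j _ hij
    simp only [v] at hij
    field_simp at hij
    exact_mod_cast (add_right_cancel hij).symm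
  have hvp : ∀ i, 0 < v i := fun i => by positivity
  have hvτ : ∀ i, v i ≤ τ := fun i => div_le_self hτ.le (by linarith [Nat.cast_nonneg (α := ℝ) i])
  have hint : ∀ i, Integrable (fun x => (1 + v i • fderiv ℝ h x).det) (μ.restrict B) := by
    intro i
    have hc : ContinuousOn (fun x => (1 + v i • fderiv ℝ h x).det) (closedBall 0 1) :=
      ContinuousLinearMap.continuous_det.comp_continuousOn
        (continuousOn_const.add (show ContinuousOn (fun x => v i • fderiv ℝ h x) _ from
          hcont.const_smul (v i)))
    exact (hc.integrableOn_compact (isCompact_closedBall _ _)).mono_set ball_subset_closedBall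
  have hfin : (0 : ℝ) = μ.real B := by
    calc (0 : ℝ) = ∫ x in B, (1 + (1 : ℝ) • fderiv ℝ h x).det ∂μ := by
          rw [setIntegral_congr_fun measurableSet_ball hzero]; simp
      _ = ∫ x in B, ∑ i ∈ Finset.range (n + 1), (1 + v i • fderiv ℝ h x).det *
            (Lagrange.basis (Finset.range (n + 1)) v i).eval 1 ∂μ := by
          simp_rw [det_interp v hv _ 1]
      _ = ∑ i ∈ Finset.range (n + 1), μ.real B *
            (Lagrange.basis (Finset.range (n + 1)) v i).eval 1 := by
          rw [integral_finsetSum _ (fun i _ => (hint i).mul_const _)]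
          refine Finset.sum_congr rfl fun i _ => ?_
          rw [integral_mul_const, hkey _ (hvp i) (hvτ i)]
      _ = μ.real B := by
          rw [← Finset.mul_sum, ← Polynomial.eval_finsetSum,
            Lagrange.sum_basis hv (by simp), Polynomial.eval_one, mul_one]
  have hpos : 0 < μ.real B :=
    ENNReal.toReal_pos (measure_ball_pos μ _ one_pos).ne' measure_ball_lt_top.ne
  linarith

theorem brouwer_smooth_s14 {n : ℕ} (g : EuclideanSpace ℝ (Fin n) → EuclideanSpace ℝ (Fin n))
    (hg : ContDiff ℝ 1 g) (hb : ∀ x, ‖g x‖ ≤ 1) : ∃ x, g x = x := by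
  by_contra! hne
  let u := fun x => x - g x
  have hu : ∀ x, u x ≠ 0 := fun x h => hne x (sub_eq_zero.mp h).symm
  have hup : ∀ x, 0 < ‖u x‖ ^ 2 := fun x => by have := norm_pos_iff.mpr (hu x); positivity
  have huC : ContDiff ℝ 1 u := contDiff_id.sub hg
  let D := fun x => (inner ℝ x (u x)) ^ 2 + ‖u x‖ ^ 2 * (1 - ‖x‖ ^ 2)
  have hsph : ∀ x, ‖x‖ = 1 → 0 < inner ℝ x (u x) := by
    intro x hx
    have h1 : inner ℝ x (u x) = 1 - inner ℝ x (g x) := by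
      simp only [u]; rw [inner_sub_right, real_inner_self_eq_norm_sq, hx]; norm_num
    have h2 : ‖u x‖ ^ 2 = 1 - 2 * inner ℝ x (g x) + ‖g x‖ ^ 2 := by
      simp only [u]; rw [norm_sub_sq_real, hx]; norm_num
    have h3 : ‖g x‖ ^ 2 ≤ 1 := pow_le_one₀ (norm_nonneg _) (hb x)
    linarith [hup x]
  have hD : ∀ x, ‖x‖ ≤ 1 → 0 < D x := by
    intro x hx
    rcases hx.lt_or_eq with hx | hx
    · have : ‖x‖ ^ 2 < 1 := pow_lt_one₀ (norm_nonneg _) hx (by norm_num)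
      have := mul_pos (hup x) (sub_pos.mpr this)
      simp only [D]; positivity
    · have := hsph x hx
      simp only [D, hx]; norm_num; positivity
  have hDC : ContDiff ℝ 1 D :=
    ((contDiff_id.inner ℝ huC).pow 2).add
      ((huC.norm_sq ℝ).mul (contDiff_const.sub (contDiff_id.norm_sq ℝ)))
  let s := fun x => (- inner ℝ x (u x) + Real.sqrt (D x)) / ‖u x‖ ^ 2
  refine no_retract (fun x => s x • u x) ?_ ?_ ?_
  · intro x hx
    have h1 : ContDiffAt ℝ 1 (fun x => Real.sqrt (D x)) x := hDC.contDiffAt.sqrt (hD x hx).ne'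
    have h2 : ContDiffAt ℝ 1 s x :=
      (((contDiff_id.inner ℝ huC).neg.contDiffAt).add h1).div
        (huC.norm_sq ℝ).contDiffAt (hup x).ne'
    exact h2.smul huC.contDiffAt
  · intro x hx
    have : s x = 0 := by
      simp only [s, D, hx]
      norm_num
      left
      rw [Real.sqrt_sq (hsph x hx).le]; ring
    simp only [this, zero_smul]
  · intro x hx
    have hs : s x * ‖u x‖ ^ 2 = - inner ℝ x (u x) + Real.sqrt (D x) :=
      div_mul_cancel₀ _ (hup x).ne'
    have hq := Real.sq_sqrt (hD x hx).le
    have hsq : ‖x + s x • u x‖ ^ 2 = 1 := by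
      rw [norm_add_sq_real, inner_smul_right, norm_smul, mul_pow, Real.norm_eq_abs, sq_abs]
      have e : Real.sqrt (D x) = s x * ‖u x‖ ^ 2 + inner ℝ x (u x) := by linarith
      rw [e] at hq
      simp only [D] at hq
      have := hup x
      apply mul_left_cancel₀ (hup x).ne'
      linarith
    exact (pow_eq_one_iff_of_nonneg (norm_nonneg _) (by norm_num)).mp hsq

/-- Dimension-independent bound: an `ε`-continuous self-map of the closed unit ball
in `ℝⁿ` has an `ε'`-fixed point for every `ε' > ε / √2`. -/
theorem main_theorem_sqrt_two (n : ℕ) (hn : 1 ≤ n) (ε : ℝ) (hε : 0 ≤ ε)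
    (f : Metric.closedBall (0 : EuclideanSpace ℝ (Fin n)) 1 →
         Metric.closedBall (0 : EuclideanSpace ℝ (Fin n)) 1)
    (hf : EpsContinuous ε f) (ε' : ℝ) (hε' : ε / Real.sqrt 2 < ε') :
    ∃ x : Metric.closedBall (0 : EuclideanSpace ℝ (Fin n)) 1,
      ‖(x : EuclideanSpace ℝ (Fin n)) - (f x : EuclideanSpace ℝ (Fin n))‖ ≤ ε' := by
  classical
  choose U hU hUd using hf
  have : CompactSpace (closedBall (0 : EuclideanSpace ℝ (Fin n)) 1) :=
    isCompact_iff_compactSpace.mp (isCompact_closedBall _ _)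
  obtain ⟨δ₀, hδ₀, hleb⟩ := lebesgue_number_lemma_of_metric
    (isCompact_univ (X := closedBall (0 : EuclideanSpace ℝ (Fin n)) 1))
    (c := fun x => interior (U x)) (fun _ => isOpen_interior)
    (fun x _ => mem_iUnion.mpr ⟨x, mem_interior_iff_mem_nhds.mpr (hU x)⟩)
  let δ := min δ₀ (ε' - ε / Real.sqrt 2)
  have hδ : 0 < δ := lt_min hδ₀ (sub_pos.mpr hε')
  let S : EuclideanSpace ℝ (Fin n) → Set (EuclideanSpace ℝ (Fin n)) := fun x =>
    {z | ∃ y : closedBall (0 : EuclideanSpace ℝ (Fin n)) 1, dist (y : EuclideanSpace ℝ (Fin n)) x < δ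
      ∧ (f y : EuclideanSpace ℝ (Fin n)) = z}
  let t : EuclideanSpace ℝ (Fin n) → Set (EuclideanSpace ℝ (Fin n)) := fun x =>
    if x ∈ closedBall (0 : EuclideanSpace ℝ (Fin n)) 1 then convexHull ℝ (S x)
    else closedBall 0 1
  obtain ⟨g, hg⟩ := exists_contMDiffMap_forall_mem_convex_of_local_const
    (modelWithCornersSelf ℝ (EuclideanSpace ℝ (Fin n))) (t := t) (n := 1)
    (fun x => by
      by_cases hx : x ∈ closedBall (0 : EuclideanSpace ℝ (Fin n)) 1
      · simp only [t, if_pos hx]; exact convex_convexHull _ _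
      · simp only [t, if_neg hx]; exact convex_closedBall _ _)
    (fun x => by
      by_cases hx : x ∈ closedBall (0 : EuclideanSpace ℝ (Fin n)) 1
      · refine ⟨f ⟨x, hx⟩, ?_⟩
        filter_upwards [ball_mem_nhds x hδ] with y hy
        by_cases hy1 : y ∈ closedBall (0 : EuclideanSpace ℝ (Fin n)) 1
        · simp only [t, if_pos hy1]
          exact subset_convexHull _ _ ⟨⟨x, hx⟩, mem_ball'.mp hy, rfl⟩
        · simp only [t, if_neg hy1]
          exact (f ⟨x, hx⟩).2
      · refine ⟨0, ?_⟩
        filter_upwards [isClosed_closedBall.isOpen_compl.mem_nhds hx] with y hy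
        have hy1 : y ∉ closedBall (0 : EuclideanSpace ℝ (Fin n)) 1 := hy
        simp only [t, if_neg hy1]
        simp)
  have hgb : ∀ x, ‖g x‖ ≤ 1 := by
    intro x
    have h1 := hg x
    by_cases hx : x ∈ closedBall (0 : EuclideanSpace ℝ (Fin n)) 1
    · simp only [t, if_pos hx] at h1
      have h2 : convexHull ℝ (S x) ⊆ closedBall 0 1 := by
        apply convexHull_min _ (convex_closedBall _ _)
        rintro _ ⟨y, -, rfl⟩
        exact (f y).2
      simpa using h2 h1
    · simp only [t, if_neg hx] at h1
      simpa using h1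
  have hgC : ContDiff ℝ 1 g := g.contMDiff.contDiff
  obtain ⟨x, hx⟩ := brouwer_smooth_s14 g hgC hgb
  have hxB : x ∈ closedBall (0 : EuclideanSpace ℝ (Fin n)) 1 := by
    have := hgb x
    rw [hx] at this
    simpa using this
  have hxt := hg x
  rw [hx] at hxt
  simp only [t, if_pos hxB] at hxt
  obtain ⟨i, hi⟩ := hleb ⟨x, hxB⟩ (mem_univ _)
  have hmem : ∀ y : closedBall (0 : EuclideanSpace ℝ (Fin n)) 1,
      dist (y : EuclideanSpace ℝ (Fin n)) x < δ → y ∈ U i := fun y hy =>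
    interior_subset (hi (mem_ball.mpr (lt_of_lt_of_le hy (min_le_left _ _))))
  obtain ⟨_, ⟨y, hy, rfl⟩, hs⟩ := sqrt_two_convex hε (S := S x) (by
    rintro _ ⟨a, ha, rfl⟩ _ ⟨b, hb, rfl⟩
    exact hUd i a (hmem a ha) b (hmem b hb)) hxt
  refine ⟨y, ?_⟩
  have h1 := norm_sub_le_norm_sub_add_norm_sub (y : EuclideanSpace ℝ (Fin n)) x (f y)
  rw [dist_eq_norm] at hy
  have h2 : δ ≤ ε' - ε / Real.sqrt 2 := min_le_right _ _
  linarith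
end
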